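/- Let S be a pseudo-nilpotent finite semigroup with principal series S = S_1 ⊃ S_2 ⊃ ... ⊃ S_m ⊃ S_{m+1} = ∅. Then the union K of all isolated subsets S_i \ S_{i+1} is the largest Mal'cev nilpotent ideal of S, and K equals the set of all isolated vertices of the upper non-nilpotent graph N_S (possibly K = ∅). -/

import Mathlib

/-- One multiplication step `a · w · b` where `w` ranges over `S¹`
(`none` playing the role of the adjoined identity). -/
def mulW {S : Type*} [Semigroup S] (a : S) (w : Option S) (b : S) : S :=
  match w with
  | none => a * b
  | some c => a * c * b

/-- The Mal'cev sequences: `(malcev x y w n).1 = λ_n` and `(malcev x y w n).2 = ρ_n`,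
with `λ_0 = x`, `ρ_0 = y`, `λ_{n+1} = λ_n w_{n+1} ρ_n`, `ρ_{n+1} = ρ_n w_{n+1} λ_n`. -/
def malcev {S : Type*} [Semigroup S] (x y : S) (w : ℕ → Option S) : ℕ → S × S
  | 0 => (x, y)
  | n + 1 =>
      let p := malcev x y w n
      (mulW p.1 (w n) p.2, mulW p.2 (w n) p.1)

/-- Mal'cev nilpotency of a (multiplicatively closed) subset `A` of `S`,
computed with parameters from `A¹`. -/
def SetMN {S : Type*} [Semigroup S] (A : Set S) : Prop :=
  ∃ n : ℕ, 0 < n ∧ ∀ x ∈ A, ∀ y ∈ A, ∀ w : ℕ → Option S,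
    (∀ k c, w k = some c → c ∈ A) →
    (malcev x y w n).1 = (malcev x y w n).2

/-- A semigroup is Mal'cev nilpotent. -/
def IsMN (S : Type*) [Semigroup S] : Prop := SetMN (Set.univ : Set S)

/-- Equality in the Rees quotient by (the possibly empty ideal) `I`. -/
def ReesEq {S : Type*} [Semigroup S] (I : Set S) (a b : S) : Prop :=
  a = b ∨ (a ∈ I ∧ b ∈ I)

/-- Mal'cev nilpotency of the Rees quotient `A / I` (computed by lifting to `A`). -/
def SetMNMod {S : Type*} [Semigroup S] (I A : Set S) : Prop :=
  ∃ n : ℕ, 0 < n ∧ ∀ x ∈ A, ∀ y ∈ A, ∀ w : ℕ → Option S,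
    (∀ k c, w k = some c → c ∈ A) →
    ReesEq I (malcev x y w n).1 (malcev x y w n).2

/-- `I` is an ideal of (the mul-closed subset) `T`; the empty set counts as an ideal. -/
def IsIdealIn {S : Type*} [Semigroup S] (T I : Set S) : Prop :=
  I ⊆ T ∧ ∀ a ∈ I, ∀ t ∈ T, t * a ∈ I ∧ a * t ∈ I

/-- Edge of the upper non-nilpotent graph `N_S`: `⟨a,b⟩` is not Mal'cev nilpotent. -/
def NEdge {S : Type*} [Semigroup S] (a b : S) : Prop :=
  a ≠ b ∧ ¬ SetMN (Subsemigroup.closure ({a, b} : Set S) : Set S)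

/-- The generating set of the subsemigroup `⟨x, y, w_1, …, w_m⟩`. -/
def genSet {S : Type*} [Semigroup S] (x y : S) (w : ℕ → Option S) (m : ℕ) : Set S :=
  {x, y} ∪ {c | ∃ k, k < m ∧ w k = some c}

/-- A pseudo-nilpotent semigroup. -/
def IsPN (S : Type*) [Semigroup S] : Prop :=
  ∀ (x y : S) (w : ℕ → Option S) (m : ℕ) (I : Set S),
    IsIdealIn (Subsemigroup.closure (genSet x y w m) : Set S) I →
    (malcev x y w m).1 ∉ I → (malcev x y w m).2 ∉ I →
    (∃ t, t < m ∧ (malcev x y w t).1 ≠ (malcev x y w t).2 ∧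
      malcev x y w t = malcev x y w m) →
    ∀ i ≤ m, ¬ SetMNMod I
      (Subsemigroup.closure ({(malcev x y w i).1, (malcev x y w i).2} : Set S) : Set S)

/-- A principal series `S = S_1 ⊃ S_2 ⊃ ⋯ ⊃ S_m ⊃ S_{m+1} = ∅` of a semigroup:
a strictly decreasing chain of ideals with no ideal strictly between consecutive
terms (the empty set counts as an ideal). -/
structure PrincipalSeries (S : Type*) [Semigroup S] where
  m : ℕ
  C : ℕ → Set S
  first : C 1 = Set.univ
  last : C (m + 1) = ∅
  ideal : ∀ i, 1 ≤ i → i ≤ m → IsIdealIn Set.univ (C i)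
  ssub : ∀ i, 1 ≤ i → i ≤ m → C (i + 1) ⊂ C i
  maximal : ∀ i, 1 ≤ i → i ≤ m → ∀ I : Set S, IsIdealIn Set.univ I →
    C (i + 1) ⊆ I → I ⊆ C i → I = C (i + 1) ∨ I = C i

variable {S : Type*} [Semigroup S]

/-- `F_{S_j/S_{j+1}}(S/S_{j+1})`, computed in `S`:  the elements `s ∉ S_j` with
`s·a ≠ θ` or `a·s ≠ θ` in `S/S_{j+1}` for some `a` in the ideal `S_j/S_{j+1}`. -/
def FsetQ (ps : PrincipalSeries S) (j : ℕ) : Set S :=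
  {s | s ∉ ps.C j ∧ ∃ a ∈ ps.C j, s * a ∉ ps.C (j + 1) ∨ a * s ∉ ps.C (j + 1)}

/-- `S_i \ S_{i+1}` is a root: the principal factor `S_i/S_{i+1}` is not Mal'cev
nilpotent and there is no `N_S`-edge between `S_i \ S_{i+1}` and `S_{i+1}`. -/
def Root (ps : PrincipalSeries S) (i : ℕ) : Prop :=
  ¬ SetMNMod (ps.C (i + 1)) (ps.C i) ∧
  ∀ a ∈ ps.C i \ ps.C (i + 1), ∀ b ∈ ps.C (i + 1), ¬ NEdge a b

/-- `S_i \ S_{i+1}` is an isolated subset: it is not a root, and whenever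
`S_i \ S_{i+1} ⊆ F_{S_j/S_{j+1}}(S/S_{j+1})` the factor `S_j/S_{j+1}` is nilpotent. -/
def Isolated (ps : PrincipalSeries S) (i : ℕ) : Prop :=
  ¬ Root ps i ∧
  ∀ j, 1 ≤ j → j ≤ ps.m → ps.C i \ ps.C (i + 1) ⊆ FsetQ ps j →
    SetMNMod (ps.C (j + 1)) (ps.C j)

/-- `K`, the union of all isolated subsets `S_i \ S_{i+1}`. -/
def Kset (ps : PrincipalSeries S) : Set S :=
  {a | ∃ i, 1 ≤ i ∧ i ≤ ps.m ∧ Isolated ps i ∧ a ∈ ps.C i \ ps.C (i + 1)}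

/-- The stem `S^{(i)} = F_{S_i/S_{i+1}}(S/S_{i+1}) ∪ (S_i \ S_{i+1})` of a root. -/
def Stem (ps : PrincipalSeries S) (i : ℕ) : Set S :=
  FsetQ ps i ∪ (ps.C i \ ps.C (i + 1))

/-- The `J`-preorder of a monoid: `a` lies in the ideal generated by `b`. -/
def JLe {M : Type*} [Monoid M] (a b : M) : Prop := ∃ p q : M, p * b * q = a

/-- Green's relation `J`. -/
def JEq {M : Type*} [Monoid M] (a b : M) : Prop := JLe a b ∧ JLe b a

/-- Green's relation `R`. -/
def REq {M : Type*} [Monoid M] (a b : M) : Prop := ∃ u v : M, a * u = b ∧ b * v = a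

/-- Green's relation `L`. -/
def LEq {M : Type*} [Monoid M] (a b : M) : Prop := ∃ u v : M, u * a = b ∧ v * b = a

/-- A set of pairs of distinct elements of the `J`-class of `z` that is closed under some
Mal'cev step at each of its members. -/
def JLive {M : Type*} [Monoid M] (z : M) (B : Set (M × M)) : Prop :=
  ∀ a b, (a, b) ∈ B → a ≠ b ∧ JEq z a ∧ JEq z b ∧ ∃ w, (a * w * b, b * w * a) ∈ B

section Monoid

variable {M : Type*} [Monoid M]

theorem JLe.refl (a : M) : JLe a a := ⟨1, 1, by simp⟩

theorem JLe.trans {a b c : M} (h : JLe a b) (h' : JLe b c) : JLe a c := by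
  obtain ⟨p, q, rfl⟩ := h
  obtain ⟨p', q', rfl⟩ := h'
  exact ⟨p * p', q' * q, by simp only [mul_assoc]⟩

theorem JLe.mul_left (a b : M) : JLe (a * b) b := ⟨a, 1, by simp⟩

theorem JLe.mul_right (a b : M) : JLe (a * b) a := ⟨1, b, by simp⟩

theorem JEq.symm {a b : M} (h : JEq a b) : JEq b a := ⟨h.2, h.1⟩

theorem JEq.trans {a b c : M} (h : JEq a b) (h' : JEq b c) : JEq a c :=
  ⟨h.1.trans h'.1, h'.2.trans h.2⟩

theorem REq.symm {a b : M} (h : REq a b) : REq b a := by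
  obtain ⟨u, v, h1, h2⟩ := h
  exact ⟨v, u, h2, h1⟩

theorem REq.trans {a b c : M} (h : REq a b) (h' : REq b c) : REq a c := by
  obtain ⟨u, v, rfl, h2⟩ := h
  obtain ⟨u', v', rfl, h2'⟩ := h'
  exact ⟨u * u', v' * v, by simp only [mul_assoc], by rw [← mul_assoc, h2', h2]⟩

theorem LEq.symm {a b : M} (h : LEq a b) : LEq b a := by
  obtain ⟨u, v, h1, h2⟩ := h
  exact ⟨v, u, h2, h1⟩

theorem LEq.trans {a b c : M} (h : LEq a b) (h' : LEq b c) : LEq a c := by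
  obtain ⟨u, v, rfl, h2⟩ := h
  obtain ⟨u', v', rfl, h2'⟩ := h'
  exact ⟨u' * u, v * v', by simp only [mul_assoc], by rw [mul_assoc, h2', h2]⟩

theorem REq.jEq {a b : M} (h : REq a b) : JEq a b := by
  obtain ⟨u, v, h1, h2⟩ := h
  exact ⟨h2 ▸ JLe.mul_right b v, h1 ▸ JLe.mul_right a u⟩

theorem exists_pow_right_fixes [Finite M] {a p g : M} (h : p * a * g = a) :
    ∃ k : ℕ, a * g ^ (k + 1) = a := by
  have key : ∀ n : ℕ, p ^ n * a * g ^ n = a := by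
    intro n
    induction n with
    | zero => simp
    | succ n ih =>
      calc p ^ (n + 1) * a * g ^ (n + 1) = p ^ n * (p * a * g) * g ^ n := by
            rw [pow_succ, pow_succ']; simp only [mul_assoc]
        _ = a := by rw [h, ih]
  obtain ⟨i, j, hij, he⟩ : ∃ i j : ℕ, i < j ∧ g ^ i = g ^ j := by
    obtain ⟨i, j, hne, he⟩ := Finite.exists_ne_map_eq_of_infinite (fun n : ℕ => g ^ n)
    rcases lt_or_gt_of_ne hne with h | h
    · exact ⟨i, j, h, he⟩
    · exact ⟨j, i, h, he.symm⟩
  obtain ⟨k, rfl⟩ := Nat.exists_eq_add_of_lt hij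
  refine ⟨k, ?_⟩
  have h1 : p ^ i * a * g ^ (i + k + 1) = a := by rw [← he]; exact key i
  rw [add_assoc, pow_add, ← mul_assoc, key i] at h1
  exact h1

theorem exists_pow_left_fixes [Finite M] {a p g : M} (h : p * a * g = a) :
    ∃ k : ℕ, p ^ (k + 1) * a = a := by
  have h' : MulOpposite.op g * MulOpposite.op a * MulOpposite.op p = MulOpposite.op a := by
    simp only [← MulOpposite.op_mul, ← mul_assoc, h]
  have : Finite Mᵐᵒᵖ := Finite.of_equiv M MulOpposite.opEquiv
  obtain ⟨k, hk⟩ := exists_pow_right_fixes h'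
  refine ⟨k, ?_⟩
  rwa [← MulOpposite.op_pow, ← MulOpposite.op_mul, MulOpposite.op_inj] at hk

theorem rEq_mul_of_jLe [Finite M] {a b : M} (h : JLe a (a * b)) : REq a (a * b) := by
  obtain ⟨p, q, h⟩ := h
  have h' : p * a * (b * q) = a := by simpa only [mul_assoc] using h
  obtain ⟨k, hk⟩ := exists_pow_right_fixes h'
  refine ⟨b, q * (b * q) ^ k, rfl, ?_⟩
  rw [pow_succ'] at hk
  simpa only [mul_assoc] using hk

theorem lEq_mul_of_jLe [Finite M] {a b : M} (h : JLe b (a * b)) : LEq b (a * b) := by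
  obtain ⟨p, q, h⟩ := h
  have h' : (p * a) * b * q = b := by simpa only [mul_assoc] using h
  obtain ⟨k, hk⟩ := exists_pow_left_fixes h'
  refine ⟨a, (p * a) ^ k * p, rfl, ?_⟩
  rw [pow_succ] at hk
  simpa only [mul_assoc] using hk

theorem exists_rEq_lEq [Finite M] {x m : M} (h : JEq x m) : ∃ a, REq x a ∧ LEq m a := by
  obtain ⟨p, q, hx⟩ := h.1
  have h1 : JLe (p * m) (p * m * q) := by rw [hx]; exact (JLe.mul_left p m).trans h.2
  have h2 : JLe m (p * m) := by
    refine h.2.trans ?_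
    rw [← hx]; exact JLe.mul_right _ _
  refine ⟨p * m, ?_, lEq_mul_of_jLe h2⟩
  have := rEq_mul_of_jLe h1
  rw [hx] at this
  exact this.symm

/-- The pairs in the `L`-class of `m` whose entries are `R`-related to `x` and `y`. -/
def rectPairs (x y m : M) : Set (M × M) :=
  {p | REq x p.1 ∧ REq y p.2 ∧ LEq m p.1 ∧ LEq m p.2}

theorem rectPairs_nonempty [Finite M] {z x y m : M} (hx : JEq z x) (hy : JEq z y)
    (hm : JEq z m) : ∃ a b, (a, b) ∈ rectPairs x y m := by
  obtain ⟨a, ha, ha'⟩ := exists_rEq_lEq (hx.symm.trans hm)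
  obtain ⟨b, hb, hb'⟩ := exists_rEq_lEq (hy.symm.trans hm)
  exact ⟨a, b, ha, hb, ha', hb'⟩

theorem rectPairs_live [Finite M] {z x y m t : M} (hx : JEq z x) (hy : JEq z y)
    (ht : JEq z t) (hxy : ¬ REq x y)
    (htx : JLe z (t * x)) (hty : JLe z (t * y)) : JLive z (rectPairs x y m) := by
  rintro a b ⟨hxa, hyb, hma, hmb⟩
  dsimp only at hxa hyb hma hmb
  have hza : JEq z a := hx.trans hxa.jEq
  have hzb : JEq z b := hy.trans hyb.jEq
  refine ⟨?_, hza, hzb, ?_⟩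
  · rintro rfl
    exact hxy (hxa.trans hyb.symm)
  obtain ⟨c, ⟨h, -, hh, -⟩, -, c', -, hc⟩ := exists_rEq_lEq (hza.symm.trans ht)
  obtain ⟨-, r, -, hr⟩ := hma.symm.trans hmb
  have hta : JLe z (t * a) := by
    obtain ⟨-, v, -, hv⟩ := hxa
    refine htx.trans ?_
    rw [← hv, ← mul_assoc]; exact JLe.mul_right _ _
  have htb : JLe z (t * b) := by
    obtain ⟨-, v, -, hv⟩ := hyb
    refine hty.trans ?_
    rw [← hv, ← mul_assoc]; exact JLe.mul_right _ _
  have hab : JLe z (a * h * b) := by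
    refine htb.trans ?_
    rw [← hc, ← hh, mul_assoc c']; exact JLe.mul_left _ _
  have hba : JLe z (b * h * a) := by
    refine hta.trans ⟨c' * r, 1, ?_⟩
    rw [← hc, ← hh, ← hr]; simp only [mul_assoc, mul_one]
  refine ⟨h, ?_⟩
  change REq x (a * h * b) ∧ REq y (b * h * a) ∧ LEq m (a * h * b) ∧ LEq m (b * h * a)
  refine ⟨hxa.trans ?_, hyb.trans ?_, hmb.trans ?_, hma.trans ?_⟩
  · have := hza.2.trans hab
    rw [mul_assoc] at this ⊢
    exact rEq_mul_of_jLe this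
  · have := hzb.2.trans hba
    rw [mul_assoc] at this ⊢
    exact rEq_mul_of_jLe this
  · exact lEq_mul_of_jLe (hzb.2.trans hab)
  · exact lEq_mul_of_jLe (hza.2.trans hba)

theorem jLe_mul_of_not_rEq [Finite M] {z x y m t : M}
    (H : ∀ B, JLive z B → ∀ a b, (a, b) ∈ B → JLe z (a * a) ∨ JLe z (b * a))
    (hx : JEq z x) (hy : JEq z y) (ht : JEq z t) (hm : JEq z m) (hxy : ¬ REq x y)
    (htx : JLe z (t * x)) (hty : JLe z (t * y)) : JLe z (m * x) := by
  obtain ⟨a, b, hab⟩ := rectPairs_nonempty hx hy hm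
  have h := H _ (rectPairs_live hx hy ht hxy htx hty) a b hab
  obtain ⟨⟨u, -, rfl, -⟩, -, ⟨p, -, hp, -⟩, ⟨q, -, rfl, -⟩⟩ := hab
  rcases h with h | h
  · refine h.trans ⟨p, u, ?_⟩
    conv_rhs => rw [← mul_assoc]
    rw [← mul_assoc, hp]
  · exact h.trans ⟨q, u, by simp only [mul_assoc]⟩

theorem jLe_mul_of_jEq [Finite M] {z x y t : M}
    (H : ∀ B, JLive z B → ∀ a b, (a, b) ∈ B → JLe z (a * a) ∨ JLe z (b * a))
    (hx : JEq z x) (hy : JEq z y) (ht : JEq z t) (hxy : ¬ REq x y)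
    (htx : JLe z (t * x)) (hty : JLe z (t * y)) {m k : M} (hm : JEq z m) (hk : JEq z k) :
    JLe z (m * k) := by
  have hx' : ∀ m, JEq z m → JLe z (m * x) := fun m hm =>
    jLe_mul_of_not_rEq H hx hy ht hm hxy htx hty
  by_cases hkx : REq k x
  · obtain ⟨u, -, rfl, -⟩ := hkx
    refine (hx' m hm).trans ?_
    rw [← mul_assoc]; exact JLe.mul_right _ _
  · obtain ⟨p, q, rfl⟩ := hx.2.trans hk.1
    have h1 : JLe z (t * p * k) := by
      refine htx.trans ⟨1, q, by simp only [mul_assoc, one_mul]⟩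
    have h2 : JEq z (t * p) :=
      ⟨h1.trans (JLe.mul_right _ _), (JLe.mul_right _ _).trans ht.2⟩
    exact jLe_mul_of_not_rEq H hk hx h2 hm hkx h1 (hx' _ h2)

theorem exists_step_live_of_not_rEq [Finite M] {z x y t : M}
    (H : ∀ B, JLive z B → ∀ a b, (a, b) ∈ B → JLe z (a * a) ∨ JLe z (b * a))
    (hx : JEq z x) (hy : JEq z y) (ht : JEq z t) (hxy : ¬ REq x y)
    (htx : JLe z (t * x)) (hty : JLe z (t * y)) {s : M} (hs : JLe z s) :
    ∃ b w B, JEq z b ∧ JLive z B ∧ (s * w * b, b * w * s) ∈ B := by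
  have full : ∀ {m k : M}, JEq z m → JEq z k → JLe z (m * k) := fun hm hk =>
    jLe_mul_of_jEq H hx hy ht hxy htx hty hm hk
  have hz : JEq z z := ⟨JLe.refl z, JLe.refl z⟩
  obtain ⟨p, q, hpq⟩ := hs
  have h1 : JLe z (s * (q * z)) := by
    refine (full hz hz).trans ⟨p, 1, ?_⟩
    nth_rw 2 [← hpq]; simp only [mul_assoc, mul_one]
  have h2 : JLe z (z * p * s) := by
    refine (full hz hz).trans ⟨1, q, ?_⟩
    nth_rw 3 [← hpq]; simp only [mul_assoc, one_mul]
  have hq : JEq z (q * z) := ⟨h1.trans (JLe.mul_left _ _), JLe.mul_left _ _⟩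
  have hp : JEq z (z * p) := ⟨h2.trans (JLe.mul_right _ _), JLe.mul_right _ _⟩
  have hsq : JEq z (s * (q * z)) := ⟨h1, (JLe.mul_left _ _).trans hq.2⟩
  have hps : JEq z (z * p * s) := ⟨h2, (JLe.mul_right _ _).trans hp.2⟩
  obtain ⟨y0, hy0, hn⟩ : ∃ y0, JEq z y0 ∧ ¬ REq (s * (q * z)) y0 := by
    by_contra! hcon
    exact hxy ((hcon x hx).symm.trans (hcon y hy))
  obtain ⟨b, hyb, hmb⟩ := exists_rEq_lEq (hy0.symm.trans hps)
  have hb : JEq z b := hy0.trans hyb.jEq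
  have hn' : ¬ REq (s * (q * z)) b := fun h => hn (h.trans hyb.symm)
  have hqp : JEq z (q * z * (z * p)) :=
    ⟨full hq hp, (JLe.mul_right _ _).trans hq.2⟩
  have hsqp : JEq z (s * (q * z) * (z * p)) :=
    ⟨full hsq hp, (JLe.mul_right _ _).trans hsq.2⟩
  have hbqp : JEq z (b * (q * z)) := ⟨full hb hq, (JLe.mul_right _ _).trans hb.2⟩
  have e1 : s * (q * z * (z * p)) * b = s * (q * z) * ((z * p) * b) := by
    simp only [mul_assoc]
  have e1' : s * (q * z * (z * p)) * b = (s * (q * z) * (z * p)) * b := by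
    simp only [mul_assoc]
  have e2 : b * (q * z * (z * p)) * s = b * (q * z * ((z * p) * s)) := by
    simp only [mul_assoc]
  have e2' : b * (q * z * (z * p)) * s = b * (q * z) * ((z * p) * s) := by
    simp only [mul_assoc]
  have g1 : JLe z (s * (q * z * (z * p)) * b) := by rw [e1']; exact full hsqp hb
  have g2 : JLe z (b * (q * z * (z * p)) * s) := by rw [e2']; exact full hbqp hps
  refine ⟨b, q * z * (z * p), _, hb,
    rectPairs_live hsq hb hz hn' (full hz hsq) (full hz hb) (m := z * p * s), ?_, ?_, ?_, ?_⟩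
  · dsimp only
    rw [e1] at g1 ⊢
    exact rEq_mul_of_jLe (hsq.2.trans g1)
  · dsimp only
    rw [e2] at g2 ⊢
    exact rEq_mul_of_jLe (hb.2.trans g2)
  · dsimp only
    rw [e1'] at g1 ⊢
    exact hmb.trans (lEq_mul_of_jLe (hb.2.trans g1))
  · dsimp only
    rw [e2'] at g2 ⊢
    exact lEq_mul_of_jLe (hps.2.trans g2)

theorem JLe.op {a b : M} (h : JLe a b) : JLe (MulOpposite.op a) (MulOpposite.op b) := by
  obtain ⟨p, q, rfl⟩ := h
  exact ⟨MulOpposite.op q, MulOpposite.op p, by simp only [MulOpposite.op_mul, mul_assoc]⟩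

theorem JLe.unop {a b : Mᵐᵒᵖ} (h : JLe a b) : JLe a.unop b.unop := by
  obtain ⟨p, q, rfl⟩ := h
  exact ⟨q.unop, p.unop, by simp only [MulOpposite.unop_mul, mul_assoc]⟩

/-- The pairs, in either order, underlying a set of pairs in the opposite monoid. -/
def unopPairs (B : Set (Mᵐᵒᵖ × Mᵐᵒᵖ)) : Set (M × M) :=
  {p | (MulOpposite.op p.1, MulOpposite.op p.2) ∈ B ∨
    (MulOpposite.op p.2, MulOpposite.op p.1) ∈ B}

theorem JLive.unopPairs {z : Mᵐᵒᵖ} {B : Set (Mᵐᵒᵖ × Mᵐᵒᵖ)} (hB : JLive z B) :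
    JLive z.unop (unopPairs B) := by
  have main : ∀ a b : M, (MulOpposite.op a, MulOpposite.op b) ∈ B →
      a ≠ b ∧ JEq z.unop a ∧ JEq z.unop b ∧
        ∃ w, (a * w * b, b * w * a) ∈ _root_.unopPairs B := by
    intro a b h
    obtain ⟨h1, h2, h3, w, hw⟩ := hB _ _ h
    refine ⟨fun h => h1 (by rw [h]), ⟨h2.1.unop, h2.2.unop⟩, ⟨h3.1.unop, h3.2.unop⟩,
      w.unop, Or.inr ?_⟩
    simpa only [MulOpposite.op_mul, MulOpposite.op_unop, mul_assoc] using hw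
  rintro a b (h | h)
  · exact main a b h
  · obtain ⟨h1, h2, h3, w, hw⟩ := main b a h
    exact ⟨h1.symm, h3, h2, w, hw.symm⟩

theorem JLive.not_rEq_lEq [Finite M] {z : M}
    (H : ∀ B, JLive z B → ∀ a b, (a, b) ∈ B → a * b ≠ b * a)
    {B : Set (M × M)} (hB : JLive z B) {x y : M} (hxy : (x, y) ∈ B) (hR : REq x y)
    (hL : LEq x y) : False := by
  obtain ⟨-, -, hy, w, hw⟩ := hB x y hxy
  obtain ⟨-, u', -, hu'⟩ := hR
  obtain ⟨-, v', -, hv'⟩ := hL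
  have h1 : JLe y (x * w * y) := hy.2.trans (hB _ _ hw).2.1.1
  obtain ⟨-, v, -, hv⟩ := lEq_mul_of_jLe h1
  obtain ⟨k, hk⟩ : ∃ k : ℕ, y * (u' * w * y) ^ (k + 1) = y := by
    refine exists_pow_right_fixes (p := v) ?_
    conv_rhs => rw [← hv, ← hu']
    simp only [mul_assoc]
  obtain ⟨c, hc⟩ : ∃ c, y * c * y = y :=
    ⟨(u' * w * y) ^ k * (u' * w), by rw [pow_succ] at hk; simpa only [mul_assoc] using hk⟩
  have hxc : x * c * y = x := by
    rw [← hv', mul_assoc, mul_assoc, ← mul_assoc y, hc]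
  have hcx : y * c * x = x := by
    rw [← hu', ← mul_assoc, hc]
  let D : Set (M × M) :=
    {p | ∃ a b, (a, b) ∈ B ∧ a * c * y = a ∧ b * c * y = b ∧ p = (a * c, b * c)}
  have hD : JLive z D := by
    rintro _ _ ⟨a, b, hab, ha, hb, he⟩
    obtain ⟨rfl, rfl⟩ := Prod.mk.inj he
    obtain ⟨hne, hza, hzb, w, hw⟩ := hB a b hab
    refine ⟨fun h => hne (by rw [← ha, ← hb, h]), ⟨hza.1.trans ⟨1, y, by simpa using ha⟩,
      (JLe.mul_right _ _).trans hza.2⟩, ⟨hzb.1.trans ⟨1, y, by simpa using hb⟩,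
      (JLe.mul_right _ _).trans hzb.2⟩, y * w, _, _, hw, ?_, ?_, ?_⟩
    · rw [mul_assoc, mul_assoc, ← mul_assoc b, hb]
    · rw [mul_assoc, mul_assoc, ← mul_assoc a, ha]
    · refine Prod.ext ?_ ?_
      · calc a * c * (y * w) * (b * c) = a * c * y * w * b * c := by simp only [mul_assoc]
          _ = _ := by rw [ha]
      · calc b * c * (y * w) * (a * c) = b * c * y * w * a * c := by simp only [mul_assoc]
          _ = _ := by rw [hb]
  refine H D hD (x * c) (y * c) ⟨x, y, hxy, hxc, hc, rfl⟩ ?_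
  rw [← mul_assoc, hxc, ← mul_assoc, hcx]

theorem exists_step_live [Finite M] {z : M}
    (H : ∀ B, JLive z B → ∀ a b, (a, b) ∈ B → a * b ≠ b * a ∧
      (JLe z (a * a) ∨ JLe z (b * a)) ∧ (JLe z (a * a) ∨ JLe z (a * b)))
    {B : Set (M × M)} (hB : JLive z B) {x y t t' : M} (hxy : (x, y) ∈ B)
    (ht : JEq z t) (htx : JLe z (t * x)) (hty : JLe z (t * y))
    (ht' : JEq z t') (htx' : JLe z (x * t')) (hty' : JLe z (y * t')) {s : M} (hs : JLe z s) :
    ∃ b w B, JEq z b ∧ JLive z B ∧ (s * w * b, b * w * s) ∈ B := by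
  obtain ⟨-, hx, hy, -⟩ := hB x y hxy
  by_cases hR : REq x y
  · have hL : ¬ LEq x y := fun hL =>
      hB.not_rEq_lEq (fun B hB a b h => (H B hB a b h).1) hxy hR hL
    have : Finite Mᵐᵒᵖ := Finite.of_equiv M MulOpposite.opEquiv
    obtain ⟨b, w, D, hb, hD, hmem⟩ := exists_step_live_of_not_rEq (M := Mᵐᵒᵖ)
      (z := MulOpposite.op z) (x := MulOpposite.op x) (y := MulOpposite.op y)
      (t := MulOpposite.op t') (s := MulOpposite.op s)
      (by
        intro D hD a b hab
        have := (H _ hD.unopPairs a.unop b.unop (Or.inl hab)).2.2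
        exact this.imp JLe.op JLe.op)
      ⟨hx.1.op, hx.2.op⟩ ⟨hy.1.op, hy.2.op⟩ ⟨ht'.1.op, ht'.2.op⟩
      (by
        rintro ⟨u, v, h1, h2⟩
        exact hL ⟨u.unop, v.unop, MulOpposite.op_injective h1, MulOpposite.op_injective h2⟩)
      htx'.op hty'.op hs.op
    refine ⟨b.unop, w.unop, _, ⟨hb.1.unop, hb.2.unop⟩, hD.unopPairs, Or.inr ?_⟩
    simpa only [MulOpposite.op_mul, MulOpposite.op_unop, mul_assoc] using hmem
  · exact exists_step_live_of_not_rEq (fun B hB a b h => (H B hB a b h).2.1) hx hy ht hR htx hty hs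

end Monoid

section Semigroup

/-- The `J`-preorder of a semigroup. -/
def SLe (a b : S) : Prop := JLe (a : WithOne S) (b : WithOne S)

/-- A parameter of a Mal'cev step, as an element of `S¹`. -/
def paramOne {T : Type*} : Option T → WithOne T
  | none => 1
  | some c => c

theorem coe_mulW (a : S) (w : Option S) (b : S) :
    ((mulW a w b : S) : WithOne S) = a * paramOne w * b := by
  cases w <;> simp [mulW, paramOne]

theorem exists_paramOne {T : Type*} (u : WithOne T) : ∃ w : Option T, paramOne w = u := by
  exact WithOne.cases_on u ⟨none, rfl⟩ fun c => ⟨some c, rfl⟩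

theorem SLe.refl (a : S) : SLe a a := JLe.refl _

theorem SLe.trans {a b c : S} (h : SLe a b) (h' : SLe b c) : SLe a c := JLe.trans h h'

theorem SLe.mul_left (a b : S) : SLe (a * b) b := by
  rw [SLe, WithOne.coe_mul]; exact JLe.mul_left _ _

theorem SLe.mul_right (a b : S) : SLe (a * b) a := by
  rw [SLe, WithOne.coe_mul]; exact JLe.mul_right _ _

theorem mulW_sLe_left (a : S) (w : Option S) (b : S) : SLe (mulW a w b) a := by
  rw [SLe, coe_mulW, mul_assoc]; exact JLe.mul_right _ _

theorem mulW_sLe_right (a : S) (w : Option S) (b : S) : SLe (mulW a w b) b := by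
  rw [SLe, coe_mulW]; exact JLe.mul_left _ _

theorem mulW_sLe_param (a c b : S) : SLe (mulW a (some c) b) c :=
  (SLe.mul_right (a * c) b).trans (SLe.mul_left a c)

theorem IsIdealIn.mem_of_sLe {I : Set S} (hI : IsIdealIn Set.univ I) {a b : S}
    (h : SLe a b) (hb : b ∈ I) : a ∈ I := by
  obtain ⟨p, q, h⟩ := h
  obtain ⟨p, rfl⟩ := exists_paramOne p
  obtain ⟨q, rfl⟩ := exists_paramOne q
  have hl : ∀ c x, x ∈ I → c * x ∈ I := fun c x hx => (hI.2 x hx c trivial).1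
  have hr : ∀ c x, x ∈ I → x * c ∈ I := fun c x hx => (hI.2 x hx c trivial).2
  cases p <;> cases q <;> simp only [paramOne, one_mul, mul_one, ← WithOne.coe_mul,
    WithOne.coe_inj] at h <;> rw [← h]
  · exact hb
  · exact hr _ _ hb
  · exact hl _ _ hb
  · exact hr _ _ (hl _ _ hb)

/-- `A` is multiplicatively closed. -/
def MulClosed (A : Set S) : Prop := ∀ a ∈ A, ∀ b ∈ A, a * b ∈ A

theorem MulClosed.mulW_mem {A : Set S} (hA : MulClosed A) {a b : S} (ha : a ∈ A) (hb : b ∈ A)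
    {w : Option S} (hw : ∀ c, w = some c → c ∈ A) : mulW a w b ∈ A := by
  cases w with
  | none => exact hA _ ha _ hb
  | some c => exact hA _ (hA _ ha _ (hw c rfl)) _ hb

theorem mulClosed_subsemigroup (T : Subsemigroup S) : MulClosed (T : Set S) :=
  fun _ ha _ hb => T.mul_mem ha hb

/-- A set of pairs of distinct elements of `A` lying `J`-above `z` that is closed under some
Mal'cev step with parameter in `A¹` at each of its members. -/
def SLive (A : Set S) (z : S) (B : Set (S × S)) : Prop :=
  ∀ a b, (a, b) ∈ B → a ≠ b ∧ SLe z a ∧ SLe z b ∧ a ∈ A ∧ b ∈ A ∧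
    ∃ w : Option S, (∀ c, w = some c → c ∈ A) ∧ (mulW a w b, mulW b w a) ∈ B

theorem SLive.exists_malcev {A : Set S} {z : S} {B : Set (S × S)} (hB : SLive A z B) {x y : S}
    (hxy : (x, y) ∈ B) : ∃ w : ℕ → Option S, (∀ k c, w k = some c → c ∈ A) ∧
      ∀ n, malcev x y w n ∈ B := by
  have hstep : ∀ p : B, ∃ w : Option S, (∀ c, w = some c → c ∈ A) ∧
      (mulW p.1.1 w p.1.2, mulW p.1.2 w p.1.1) ∈ B := fun p => (hB p.1.1 p.1.2 p.2).2.2.2.2.2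
  choose f hf hf' using hstep
  let g : ℕ → B := fun n => Nat.rec ⟨(x, y), hxy⟩
    (fun _ p => ⟨(mulW p.1.1 (f p) p.1.2, mulW p.1.2 (f p) p.1.1), hf' p⟩) n
  refine ⟨fun n => f (g n), fun k c => hf (g k) c, fun n => ?_⟩
  suffices h : malcev x y (fun n => f (g n)) n = (g n).1 by
    rw [h]; exact (g n).2
  induction n with
  | zero => rfl
  | succ n ih => rw [malcev, ih]

theorem SLive.not_setMNMod {A I : Set S} {z : S} {B : Set (S × S)} (hB : SLive A z B)
    (hne : B.Nonempty) (hI : ∀ a ∈ I, ¬ SLe z a) : ¬ SetMNMod I A := by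
  rintro ⟨n, -, h⟩
  obtain ⟨⟨x, y⟩, hxy⟩ := hne
  obtain ⟨w, hw, hmem⟩ := hB.exists_malcev hxy
  have h1 := hB _ _ (hmem n)
  rcases h x (hB _ _ hxy).2.2.2.1 y (hB _ _ hxy).2.2.2.2.1 w hw with h | h
  · exact h1.1 h
  · exact hI _ h.1 h1.2.1

theorem SetMN.setMNMod {A : Set S} (h : SetMN A) (I : Set S) : SetMNMod I A := by
  obtain ⟨n, hn, h⟩ := h
  exact ⟨n, hn, fun x hx y hy w hw => Or.inl (h x hx y hy w hw)⟩

theorem SLive.not_setMN {A : Set S} {z : S} {B : Set (S × S)} (hB : SLive A z B)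
    (hne : B.Nonempty) : ¬ SetMN A := fun h =>
  hB.not_setMNMod hne (I := ∅) (fun a ha => absurd ha (Set.notMem_empty a)) (h.setMNMod ∅)

theorem malcev_sLe {x y : S} {w : ℕ → Option S} {i j : ℕ} (h : i < j) :
    SLe (malcev x y w j).1 (malcev x y w i).1 ∧ SLe (malcev x y w j).1 (malcev x y w i).2 ∧
    SLe (malcev x y w j).2 (malcev x y w i).1 ∧ SLe (malcev x y w j).2 (malcev x y w i).2 := by
  induction j, h using Nat.le_induction with
  | base =>
    exact ⟨mulW_sLe_left _ _ _, mulW_sLe_right _ _ _, mulW_sLe_right _ _ _,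
      mulW_sLe_left _ _ _⟩
  | succ j hj ih =>
    have h1 : SLe (malcev x y w (j + 1)).1 (malcev x y w j).1 := mulW_sLe_left _ _ _
    have h2 : SLe (malcev x y w (j + 1)).2 (malcev x y w j).2 := mulW_sLe_left _ _ _
    exact ⟨h1.trans ih.1, h1.trans ih.2.1, h2.trans ih.2.2.1, h2.trans ih.2.2.2⟩

theorem malcev_mem {A : Set S} (hA : MulClosed A) {x y : S} (hx : x ∈ A) (hy : y ∈ A)
    {w : ℕ → Option S} {n : ℕ} (hw : ∀ k < n, ∀ c, w k = some c → c ∈ A) :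
    (malcev x y w n).1 ∈ A ∧ (malcev x y w n).2 ∈ A := by
  induction n with
  | zero => exact ⟨hx, hy⟩
  | succ n ih =>
    obtain ⟨h1, h2⟩ := ih fun k hk => hw k (hk.trans n.lt_succ_self)
    exact ⟨hA.mulW_mem h1 h2 (hw n n.lt_succ_self), hA.mulW_mem h2 h1 (hw n n.lt_succ_self)⟩

theorem exists_malcev_repeat [Finite S] (x y : S) (w : ℕ → Option S) :
    ∃ t m, t < m ∧ m ≤ Nat.card (S × S) ∧ malcev x y w t = malcev x y w m := by
  have : ¬ Function.Injective (fun i : Fin (Nat.card (S × S) + 1) => malcev x y w i) := by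
    intro h
    have := Nat.card_le_card_of_injective _ h
    simp at this
  obtain ⟨i, j, he, hne⟩ := Function.not_injective_iff.1 this
  rcases lt_or_gt_of_ne hne with h | h
  · exact ⟨i, j, h, Nat.lt_succ_iff.1 j.2, he⟩
  · exact ⟨j, i, h, Nat.lt_succ_iff.1 i.2, he.symm⟩

theorem ReesEq.malcev_of_le {A I : Set S} (hI : IsIdealIn A I) {x y : S} {w : ℕ → Option S} (hw : ∀ k c, w k = some c → c ∈ A) {i j : ℕ}
    (hij : i ≤ j) (h : ReesEq I (malcev x y w i).1 (malcev x y w i).2) :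
    ReesEq I (malcev x y w j).1 (malcev x y w j).2 := by
  induction j, hij using Nat.le_induction with
  | base => exact h
  | succ j hj ih =>
    rcases ih with ih | ih
    · left
      simp only [malcev, ih]
    · right
      have hr : ∀ {a b : S}, a ∈ I → b ∈ A → mulW a (w j) b ∈ I := by
        intro a b ha hb
        have hwj := hw j
        rcases hwe : w j with _ | c
        · exact (hI.2 a ha b hb).2
        · exact (hI.2 _ (hI.2 a ha c (hwj c hwe)).2 b hb).2
      exact ⟨hr ih.1 (hI.1 ih.2), hr ih.2 (hI.1 ih.1)⟩

theorem exists_sLive_of_not_setMNMod [Finite S] {A I : Set S} (hA : MulClosed A)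
    (hI : IsIdealIn A I) (h : ¬ SetMNMod I A) :
    ∃ z ∈ A, z ∉ I ∧ ∃ B, B.Nonempty ∧ SLive A z B ∧ ∀ p ∈ B, SLe p.1 z ∧ SLe p.2 z := by
  simp only [SetMNMod, not_exists, not_and, not_forall] at h
  obtain ⟨x, hx, y, hy, w, hw, hne⟩ := h (Nat.card (S × S) + 1) (Nat.succ_pos _)
  obtain ⟨t, m, htm, hmN, he⟩ := exists_malcev_repeat x y w
  have hnr : ∀ j ≤ m, ¬ ReesEq I (malcev x y w j).1 (malcev x y w j).2 := fun j hj hr =>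
    hne (hr.malcev_of_le hI hw (by omega))
  have hmem : ∀ j, (malcev x y w j).1 ∈ A ∧ (malcev x y w j).2 ∈ A := fun j =>
    malcev_mem hA hx hy fun k _ => hw k
  have hstep : ∀ {a b : S} (j : ℕ), a ∈ I → b ∈ A →
      mulW a (w j) b ∈ I ∧ mulW b (w j) a ∈ I := by
    intro a b j ha hb
    have hwj := hw j
    rcases hwe : w j with _ | c
    · exact ⟨(hI.2 a ha b hb).2, (hI.2 a ha b hb).1⟩
    · exact ⟨(hI.2 _ (hI.2 a ha c (hwj c hwe)).2 b hb).2,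
        (hI.2 a ha _ (hA _ hb _ (hwj c hwe))).1⟩
  have hz : (malcev x y w t).1 ∉ I := fun hz =>
    hne (ReesEq.malcev_of_le hI hw (i := t + 1) (by omega)
      (Or.inr (hstep t hz (hmem t).2)))
  refine ⟨(malcev x y w t).1, (hmem t).1, hz, {p | ∃ j, t ≤ j ∧ j < m ∧ malcev x y w j = p},
    ⟨_, t, le_rfl, htm, rfl⟩, ?_, ?_⟩
  · rintro a b ⟨j, htj, hjm, hj⟩
    obtain ⟨rfl, rfl⟩ := Prod.mk.inj hj
    refine ⟨fun h => hnr j hjm.le (Or.inl h), ?_, ?_, (hmem j).1, (hmem j).2, w j, hw j, ?_⟩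
    · rw [he]; exact (malcev_sLe hjm).1
    · rw [he]; exact (malcev_sLe hjm).2.1
    · rcases Nat.lt_or_ge (j + 1) m with h | h
      · exact ⟨j + 1, by omega, h, rfl⟩
      · obtain rfl : j + 1 = m := by omega
        exact ⟨t, le_rfl, htm, he⟩
  · rintro p ⟨j, htj, hjm, rfl⟩
    rcases htj.eq_or_lt with rfl | h
    · refine ⟨SLe.refl _, ?_⟩
      rw [he]
      nth_rw 2 [← he]
      exact (malcev_sLe htm).2.2.1
    · exact ⟨(malcev_sLe h).1, (malcev_sLe h).2.2.1⟩

theorem exists_sLive_of_not_setMN [Finite S] {A : Set S} (hA : MulClosed A) (h : ¬ SetMN A) :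
    ∃ z ∈ A, ∃ B, B.Nonempty ∧ SLive A z B ∧ ∀ p ∈ B, SLe p.1 z ∧ SLe p.2 z := by
  have h' : ¬ SetMNMod ∅ A := by
    rintro ⟨n, hn, h'⟩
    exact h ⟨n, hn, fun x hx y hy w hw => (h' x hx y hy w hw).elim id fun h => absurd h.1 id⟩
  obtain ⟨z, hz, -, hB⟩ := exists_sLive_of_not_setMNMod hA
    ⟨Set.empty_subset A, fun a ha => absurd ha id⟩ h'
  exact ⟨z, hz, hB⟩

theorem SLive.mono {A : Set S} {z z' : S} {B : Set (S × S)} (hB : SLive A z B)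
    (h : SLe z' z) : SLive A z' B := by
  intro a b hab
  obtain ⟨h1, h2, h3, h4⟩ := hB a b hab
  exact ⟨h1, h.trans h2, h.trans h3, h4⟩

theorem IsPN.exists_sLive_closure [Finite S] (hPN : IsPN S) {z : S} {B : Set (S × S)}
    (hB : SLive Set.univ z B) {x y : S} (hxy : (x, y) ∈ B) :
    ∃ B', B'.Nonempty ∧ SLive (Subsemigroup.closure ({x, y} : Set S) : Set S) z B' := by
  obtain ⟨w, -, hmem⟩ := hB.exists_malcev hxy
  obtain ⟨t, m, htm, -, he⟩ := exists_malcev_repeat x y w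
  let T := Subsemigroup.closure (genSet x y w m)
  let I : Set S := {s | s ∈ T ∧ ¬ SLe z s}
  have hI : IsIdealIn (T : Set S) I := by
    refine ⟨fun s hs => hs.1, fun a ha t ht => ⟨⟨T.mul_mem ht ha.1, fun h => ?_⟩,
      ⟨T.mul_mem ha.1 ht, fun h => ?_⟩⟩⟩
    · exact ha.2 (h.trans (SLe.mul_left _ _))
    · exact ha.2 (h.trans (SLe.mul_right _ _))
  have hn := hPN x y w m I hI (fun h => h.2 (hB _ _ (hmem m)).2.1)
    (fun h => h.2 (hB _ _ (hmem m)).2.2.1) ⟨t, htm, (hB _ _ (hmem t)).1, he⟩ 0 (Nat.zero_le m)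
  let A : Subsemigroup S := Subsemigroup.closure ({x, y} : Set S)
  have hAT : A ≤ T := by
    refine Subsemigroup.closure_mono ?_
    exact Set.subset_union_left
  have hn' : ¬ SetMNMod {s | s ∈ A ∧ ¬ SLe z s} (A : Set S) := by
    rintro ⟨n, hn0, h⟩
    refine hn ⟨n, hn0, fun a ha b hb v hv => ?_⟩
    exact (h a ha b hb v hv).imp id fun h => ⟨⟨hAT h.1.1, h.1.2⟩, ⟨hAT h.2.1, h.2.2⟩⟩
  have hIA : IsIdealIn (A : Set S) {s | s ∈ A ∧ ¬ SLe z s} :=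
    ⟨fun s hs => hs.1, fun a ha t ht =>
      ⟨⟨A.mul_mem ht ha.1, fun h => ha.2 (h.trans (SLe.mul_left _ _))⟩,
        ⟨A.mul_mem ha.1 ht, fun h => ha.2 (h.trans (SLe.mul_right _ _))⟩⟩⟩
  obtain ⟨z', hz', hz'I, B', hne, hB', -⟩ := exists_sLive_of_not_setMNMod
    (mulClosed_subsemigroup A) hIA hn'
  have hzz' : SLe z z' := by
    by_contra h
    exact hz'I ⟨hz', h⟩
  exact ⟨B', hne, hB'.mono hzz'⟩

theorem SLive.exists_mulW_ne {A : Set S} {z : S} {B : Set (S × S)} (hB : SLive A z B)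
    (hne : B.Nonempty) : ∃ p ∈ A, ∃ q ∈ A, ∃ w : Option S, (∀ c, w = some c → c ∈ A) ∧
      mulW p w q ≠ mulW q w p ∧ SLe z (mulW p w q) ∧ SLe z (mulW q w p) := by
  obtain ⟨⟨p, q⟩, h⟩ := hne
  obtain ⟨-, -, -, hp, hq, w, hw, hn⟩ := hB p q h
  obtain ⟨h1, h2, h3, -⟩ := hB _ _ hn
  exact ⟨p, hp, q, hq, w, hw, h1, h2, h3⟩

theorem mulW_comm_of_mem_closure {X : Set S} (hX : ∀ a ∈ X, ∀ b ∈ X, a * b = b * a) {p q : S}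
    (hp : p ∈ Subsemigroup.closure X) (hq : q ∈ Subsemigroup.closure X) {w : Option S}
    (hw : ∀ c, w = some c → c ∈ Subsemigroup.closure X) : mulW p w q = mulW q w p := by
  have comm : ∀ a ∈ Subsemigroup.closure X, ∀ b ∈ Subsemigroup.closure X, a * b = b * a := by
    intro a ha b hb
    induction ha, hb using Subsemigroup.closure_induction₂ with
    | mem a b ha hb => exact hX a ha b hb
    | mul_left a b c _ _ _ h1 h2 => rw [mul_assoc, h2, ← mul_assoc, h1, mul_assoc]
    | mul_right a b c _ _ _ h1 h2 => rw [mul_assoc, ← h2, ← mul_assoc, h1, mul_assoc]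
  cases w with
  | none => exact comm p hp q hq
  | some c =>
    have hc := hw c rfl
    change p * c * q = q * c * p
    rw [comm p hp c hc, mul_assoc, comm p hp q hq, ← mul_assoc, comm c hc q hq]

theorem mulW_comm_of_mem_closure_singleton {b p q : S}
    (hp : p ∈ Subsemigroup.closure ({b} : Set S)) (hq : q ∈ Subsemigroup.closure ({b} : Set S))
    {w : Option S} (hw : ∀ c, w = some c → c ∈ Subsemigroup.closure ({b} : Set S)) :
    mulW p w q = mulW q w p := by
  refine mulW_comm_of_mem_closure ?_ hp hq hw
  rintro _ rfl _ rfl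
  rfl

theorem SLive.sLe_left_of_closure_pair {s b z : S} {B : Set (S × S)}
    (hB : SLive (Subsemigroup.closure ({s, b} : Set S) : Set S) z B) (hne : B.Nonempty) :
    SLe z s := by
  have key : ∀ g ∈ Subsemigroup.closure ({s, b} : Set S),
      g ∈ Subsemigroup.closure ({b} : Set S) ∨ SLe g s := by
    intro g hg
    induction hg using Subsemigroup.closure_induction with
    | mem g hg =>
      rcases hg with rfl | rfl
      · exact Or.inr (SLe.refl _)
      · exact Or.inl (Subsemigroup.subset_closure rfl)
    | mul g h _ _ ihg ihh =>
      rcases ihg with ihg | ihg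
      · rcases ihh with ihh | ihh
        · exact Or.inl (Subsemigroup.mul_mem _ ihg ihh)
        · exact Or.inr ((SLe.mul_left _ _).trans ihh)
      · exact Or.inr ((SLe.mul_right _ _).trans ihg)
  obtain ⟨p, hp, q, hq, w, hw, hn, h1, -⟩ := hB.exists_mulW_ne hne
  by_contra hzs
  have key' : ∀ g ∈ Subsemigroup.closure ({s, b} : Set S), SLe z g →
      g ∈ Subsemigroup.closure ({b} : Set S) := fun g hg h =>
    (key g hg).resolve_right fun h' => hzs (h.trans h')
  refine hn (mulW_comm_of_mem_closure_singleton (key' p hp (h1.trans (mulW_sLe_left _ _ _)))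
    (key' q hq (h1.trans (mulW_sLe_right _ _ _))) ?_)
  rintro c rfl
  exact key' c (hw c rfl) (h1.trans (mulW_sLe_param _ _ _))

theorem SLive.left_absorption {a b z : S} {B : Set (S × S)}
    (hB : SLive (Subsemigroup.closure ({a, b} : Set S) : Set S) z B) (hne : B.Nonempty) :
    SLe z (a * a) ∨ SLe z (b * a) := by
  by_contra! hcon
  let A := Subsemigroup.closure ({a, b} : Set S)
  have hbase : ∀ c ∈ A, ¬ SLe z (c * a) := by
    intro c hc
    induction hc using Subsemigroup.closure_induction with
    | mem c hc =>
      rcases hc with rfl | rfl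
      · exact hcon.1
      · exact hcon.2
    | mul c d _ _ _ ih =>
      rw [mul_assoc]
      exact fun h => ih (h.trans (SLe.mul_left _ _))
  have key : ∀ g ∈ A, g ∈ Subsemigroup.closure ({b} : Set S) ∨ ∀ c ∈ A, ¬ SLe z (c * g) := by
    intro g hg
    induction hg using Subsemigroup.closure_induction with
    | mem g hg =>
      rcases hg with rfl | rfl
      · exact Or.inr hbase
      · exact Or.inl (Subsemigroup.subset_closure rfl)
    | mul g h hg _ ihg ihh =>
      rcases ihg with ihg | ihg
      · rcases ihh with ihh | ihh
        · exact Or.inl (Subsemigroup.mul_mem _ ihg ihh)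
        · refine Or.inr fun c hc => ?_
          rw [← mul_assoc]
          exact ihh _ (A.mul_mem hc hg)
      · refine Or.inr fun c hc h' => ihg c hc ?_
        rw [← mul_assoc] at h'
        exact h'.trans (SLe.mul_right _ _)
  have key' : ∀ g ∈ A, ∀ c ∈ A, SLe z (c * g) → g ∈ Subsemigroup.closure ({b} : Set S) :=
    fun g hg c hc h => (key g hg).resolve_right fun h' => h' c hc h
  obtain ⟨p, hp, q, hq, w, hw, hn, h1, h2⟩ := hB.exists_mulW_ne hne
  rcases w with _ | c
  · exact hn (mulW_comm_of_mem_closure_singleton (key' p hp q hq h2) (key' q hq p hp h1)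
      (by rintro _ ⟨⟩))
  · have hc := hw c rfl
    refine hn (mulW_comm_of_mem_closure_singleton (key' p hp _ (A.mul_mem hq hc) h2)
      (key' q hq _ (A.mul_mem hp hc) h1) ?_)
    rintro _ ⟨⟩
    exact key' c hc p hp (h1.trans (SLe.mul_right _ _))

theorem SLive.right_absorption {a b z : S} {B : Set (S × S)}
    (hB : SLive (Subsemigroup.closure ({a, b} : Set S) : Set S) z B) (hne : B.Nonempty) :
    SLe z (a * a) ∨ SLe z (a * b) := by
  by_contra! hcon
  let A := Subsemigroup.closure ({a, b} : Set S)
  have hbase : ∀ c ∈ A, ¬ SLe z (a * c) := by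
    intro c hc
    induction hc using Subsemigroup.closure_induction with
    | mem c hc =>
      rcases hc with rfl | rfl
      · exact hcon.1
      · exact hcon.2
    | mul c d _ _ ih _ =>
      rw [← mul_assoc]
      exact fun h => ih (h.trans (SLe.mul_right _ _))
  have key : ∀ g ∈ A, g ∈ Subsemigroup.closure ({b} : Set S) ∨ ∀ c ∈ A, ¬ SLe z (g * c) := by
    intro g hg
    induction hg using Subsemigroup.closure_induction with
    | mem g hg =>
      rcases hg with rfl | rfl
      · exact Or.inr hbase
      · exact Or.inl (Subsemigroup.subset_closure rfl)
    | mul g h _ hh ihg ihh =>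
      rcases ihh with ihh | ihh
      · rcases ihg with ihg | ihg
        · exact Or.inl (Subsemigroup.mul_mem _ ihg ihh)
        · refine Or.inr fun c hc => ?_
          rw [mul_assoc]
          exact ihg _ (A.mul_mem hh hc)
      · refine Or.inr fun c hc h' => ihh c hc ?_
        rw [mul_assoc] at h'
        exact h'.trans (SLe.mul_left _ _)
  have key' : ∀ g ∈ A, ∀ c ∈ A, SLe z (g * c) → g ∈ Subsemigroup.closure ({b} : Set S) :=
    fun g hg c hc h => (key g hg).resolve_right fun h' => h' c hc h
  obtain ⟨p, hp, q, hq, w, hw, hn, h1, h2⟩ := hB.exists_mulW_ne hne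
  rcases w with _ | c
  · exact hn (mulW_comm_of_mem_closure_singleton (key' p hp q hq h1) (key' q hq p hp h2)
      (by rintro _ ⟨⟩))
  · have hc := hw c rfl
    change SLe z (p * c * q) at h1
    change SLe z (q * c * p) at h2
    rw [mul_assoc] at h1 h2
    refine hn (mulW_comm_of_mem_closure_singleton (key' p hp _ (A.mul_mem hc hq) h1)
      (key' q hq _ (A.mul_mem hc hp) h2) ?_)
    rintro _ ⟨⟩
    exact key' c hc q hq (h1.trans (SLe.mul_left _ _))

/-- `z` lies in a `J`-class carrying a nonconstant recurrent family of Mal'cev pairs. -/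
def Recurrent (z : S) : Prop :=
  ∃ B : Set (WithOne S × WithOne S), B.Nonempty ∧ JLive (z : WithOne S) B

theorem exists_coe_of_jLe {u : WithOne S} {z : S} (h : JLe u z) : ∃ a : S, (a : WithOne S) = u := by
  obtain ⟨p, q, rfl⟩ := h
  obtain ⟨p, rfl⟩ := exists_paramOne p
  obtain ⟨q, rfl⟩ := exists_paramOne q
  cases p <;> cases q <;> simp only [paramOne, one_mul, mul_one, ← WithOne.coe_mul] <;>
    exact ⟨_, rfl⟩

/-- The pairs of elements of `S` in a set of pairs of elements of `S¹`. -/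
def coePairs (B : Set (WithOne S × WithOne S)) : Set (S × S) :=
  {p | ((p.1 : WithOne S), (p.2 : WithOne S)) ∈ B}

theorem JLive.coePairs {z : S} {B : Set (WithOne S × WithOne S)} (hB : JLive (z : WithOne S) B) :
    SLive Set.univ z (coePairs B) := by
  intro a b hab
  obtain ⟨h1, h2, h3, u, hu⟩ := hB _ _ hab
  obtain ⟨w, rfl⟩ := exists_paramOne u
  refine ⟨fun h => h1 (by rw [h]), h2.1, h3.1, trivial, trivial, w, fun _ _ => trivial, ?_⟩
  change (((mulW a w b : S) : WithOne S), ((mulW b w a : S) : WithOne S)) ∈ B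
  rwa [coe_mulW, coe_mulW]

theorem JLive.exists_mem_coePairs {z : S} {B : Set (WithOne S × WithOne S)}
    (hB : JLive (z : WithOne S) B) {u v : WithOne S} (h : (u, v) ∈ B) :
    ∃ a b : S, (a : WithOne S) = u ∧ (b : WithOne S) = v ∧ (a, b) ∈ _root_.coePairs B := by
  obtain ⟨-, h2, h3, -⟩ := hB _ _ h
  obtain ⟨a, rfl⟩ := exists_coe_of_jLe h2.2
  obtain ⟨b, rfl⟩ := exists_coe_of_jLe h3.2
  exact ⟨a, b, rfl, rfl, h⟩

theorem SLive.jLive {A : Set S} {z : S} {B : Set (S × S)} (hB : SLive A z B)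
    (hle : ∀ p ∈ B, SLe p.1 z ∧ SLe p.2 z) :
    JLive (z : WithOne S) ((fun p : S × S => ((p.1 : WithOne S), (p.2 : WithOne S))) '' B) := by
  rintro _ _ ⟨⟨a, b⟩, hab, he⟩
  obtain ⟨rfl, rfl⟩ := Prod.mk.inj he
  obtain ⟨h1, h2, h3, -, -, w, -, hw⟩ := hB a b hab
  refine ⟨fun h => h1 (WithOne.coe_inj.1 h), ⟨h2, (hle _ hab).1⟩, ⟨h3, (hle _ hab).2⟩,
    paramOne w, _, hw, ?_⟩
  simp only [coe_mulW]

theorem Recurrent.exists_sLive {z : S} (h : Recurrent z) :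
    ∃ a b B, (a, b) ∈ B ∧ SLive Set.univ z B ∧ SLe a z ∧ SLe b z := by
  obtain ⟨B, ⟨⟨u, v⟩, huv⟩, hB⟩ := h
  obtain ⟨a, b, rfl, rfl, hab⟩ := hB.exists_mem_coePairs huv
  exact ⟨a, b, _, hab, hB.coePairs, (hB _ _ huv).2.1.2, (hB _ _ huv).2.2.1.2⟩

theorem sLe_of_mem_closure_pair {x y z : S} (hx : SLe x z) (hy : SLe y z) {g : S}
    (hg : g ∈ Subsemigroup.closure ({x, y} : Set S)) : SLe g z := by
  induction hg using Subsemigroup.closure_induction with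
  | mem g hg => rcases hg with rfl | rfl <;> assumption
  | mul g h _ _ _ ih => exact (SLe.mul_left _ _).trans ih

/-- The elements `t` supplied by a recurrent pair with parameters in its own `J`-class. -/
theorem exists_common_multiplier {M : Type*} [Monoid M] {z x y w w' : M}
    (hx : JEq z x)
    (hw : w = 1 ∨ JEq z w) (hw' : w' = 1 ∨ JEq z w')
    (h1 : JLe z (x * w * y)) (h2 : JLe z (y * w * x))
    (h3 : JLe z (x * w * y * w' * (y * w * x))) (h4 : JLe z (y * w * x * w' * (x * w * y))) :
    (∃ t, JEq z t ∧ JLe z (t * x) ∧ JLe z (t * y)) ∧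
      ∃ t, JEq z t ∧ JLe z (x * t) ∧ JLe z (y * t) := by
  rcases hw with rfl | hw
  · simp only [mul_one] at h1 h2 h3 h4
    rcases hw' with rfl | hw'
    · have hxx : JLe z (x * x) :=
        h4.trans ⟨y, y, by simp only [mul_one, mul_assoc]⟩
      exact ⟨⟨x, hx, hxx, h1⟩, x, hx, hxx, h2⟩
    · refine ⟨⟨w', hw', h4.trans ⟨y * x, y, by simp only [mul_assoc]⟩,
        h3.trans ⟨x * y, x, by simp only [mul_assoc]⟩⟩, w', hw',
        h4.trans ⟨y, x * y, by simp only [mul_assoc]⟩,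
        h3.trans ⟨x, y * x, by simp only [mul_assoc]⟩⟩
  · refine ⟨⟨w, hw, h2.trans ⟨y, 1, by simp only [mul_assoc, mul_one]⟩,
        h1.trans ⟨x, 1, by simp only [mul_assoc, mul_one]⟩⟩, w, hw,
        h1.trans ⟨1, y, by simp only [mul_assoc, one_mul]⟩,
        h2.trans ⟨1, x, by simp only [mul_assoc, one_mul]⟩⟩

theorem IsPN.jLive_absorption [Finite S] (hPN : IsPN S) {z : S}
    (B : Set (WithOne S × WithOne S)) (hB : JLive (z : WithOne S) B) (a b : WithOne S)
    (hab : (a, b) ∈ B) :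
    a * b ≠ b * a ∧ (JLe (z : WithOne S) (a * a) ∨ JLe (z : WithOne S) (b * a)) ∧
      (JLe (z : WithOne S) (a * a) ∨ JLe (z : WithOne S) (a * b)) := by
  obtain ⟨a, b, rfl, rfl, hab⟩ := hB.exists_mem_coePairs hab
  obtain ⟨B', hne, hB'⟩ := hPN.exists_sLive_closure hB.coePairs hab
  simp only [← WithOne.coe_mul]
  refine ⟨fun h => ?_, hB'.left_absorption hne, hB'.right_absorption hne⟩
  have hcomm : a * b = b * a := WithOne.coe_inj.1 h
  obtain ⟨p, hp, q, hq, w, hw, hn, -, -⟩ := hB'.exists_mulW_ne hne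
  refine hn (mulW_comm_of_mem_closure ?_ hp hq hw)
  rintro c (rfl | rfl) d (rfl | rfl)
  · rfl
  · exact hcomm
  · exact hcomm.symm
  · rfl

theorem IsPN.exists_sLive_pair [Finite S] (hPN : IsPN S) {z s : S} (hz : Recurrent z)
    (hs : SLe z s) : ∃ b B, (s, b) ∈ B ∧ SLive Set.univ z B := by
  have : Finite (WithOne S) := inferInstanceAs (Finite (Option S))
  obtain ⟨x₀, y₀, B₀, hxy₀, hB₀, hx₀, hy₀⟩ := hz.exists_sLive
  obtain ⟨B, ⟨⟨x, y⟩, hxy⟩, hB⟩ := hPN.exists_sLive_closure hB₀ hxy₀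
  have hA : ∀ g ∈ Subsemigroup.closure ({x₀, y₀} : Set S), SLe g z := fun g hg =>
    sLe_of_mem_closure_pair hx₀ hy₀ hg
  have hJ := hB.jLive fun p hp =>
    ⟨hA _ (hB p.1 p.2 hp).2.2.2.1, hA _ (hB p.1 p.2 hp).2.2.2.2.1⟩
  have hparam : ∀ {p q : S} {w : Option S},
      (∀ c, w = some c → c ∈ (Subsemigroup.closure ({x₀, y₀} : Set S) : Set S)) →
      SLe z (mulW p w q) → paramOne w = 1 ∨ JEq (z : WithOne S) (paramOne w) := by
    intro p q w hw h
    rcases w with _ | c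
    · exact Or.inl rfl
    · exact Or.inr ⟨h.trans (mulW_sLe_param _ _ _), hA c (hw c rfl)⟩
  obtain ⟨-, hzx, hzy, hxA, hyA, w, hw, hn⟩ := hB x y hxy
  obtain ⟨-, h1, h2, -, -, w', hw', hn'⟩ := hB _ _ hn
  obtain ⟨-, h3, h4, -⟩ := hB _ _ hn'
  have hw1 := hparam hw h1
  have hw1' := hparam hw' h3
  rw [SLe, coe_mulW] at h1 h2
  rw [SLe, coe_mulW, coe_mulW, coe_mulW] at h3 h4
  obtain ⟨⟨t, ht, htx, hty⟩, t', ht', htx', hty'⟩ :=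
    exists_common_multiplier ⟨hzx, hA x hxA⟩ hw1 hw1' h1 h2 h3 h4
  obtain ⟨b, v, D, hb, hD, hmem⟩ := exists_step_live hPN.jLive_absorption hJ
    (Set.mem_image_of_mem _ hxy) ht htx hty ht' htx' hty' hs
  obtain ⟨b, rfl⟩ := exists_coe_of_jLe hb.2
  obtain ⟨v, rfl⟩ := exists_paramOne v
  refine ⟨b, insert (s, b) (coePairs D), Set.mem_insert _ _, ?_⟩
  have hD' := hD.coePairs
  have hmem' : (mulW s v b, mulW b v s) ∈ coePairs D := by
    change (((mulW s v b : S) : WithOne S), ((mulW b v s : S) : WithOne S)) ∈ D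
    rwa [coe_mulW, coe_mulW]
  rintro c d (h | h)
  · obtain ⟨rfl, rfl⟩ := Prod.mk.inj h
    refine ⟨?_, hs, hb.1, trivial, trivial, v, fun _ _ => trivial, Or.inr hmem'⟩
    rintro rfl
    exact (hD' _ _ hmem').1 rfl
  · obtain ⟨h1, h2, h3, h4, h5, u, hu, hu'⟩ := hD' c d h
    exact ⟨h1, h2, h3, h4, h5, u, hu, Or.inr hu'⟩

theorem IsPN.exists_nEdge [Finite S] (hPN : IsPN S) {z s : S} (hz : Recurrent z)
    (hs : SLe z s) : ∃ b, NEdge s b := by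
  obtain ⟨b, B, hsb, hB⟩ := hPN.exists_sLive_pair hz hs
  obtain ⟨B', hne, hB'⟩ := hPN.exists_sLive_closure hB hsb
  exact ⟨b, (hB s b hsb).1, hB'.not_setMN hne⟩

theorem exists_recurrent_of_not_setMNMod [Finite S] {A I : Set S} (hA : MulClosed A)
    (hI : IsIdealIn A I) (h : ¬ SetMNMod I A) : ∃ z ∈ A, z ∉ I ∧ Recurrent z := by
  obtain ⟨z, hz, hzI, B, hne, hB, hle⟩ := exists_sLive_of_not_setMNMod hA hI h
  exact ⟨z, hz, hzI, _, hne.image _, hB.jLive hle⟩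

theorem exists_recurrent_of_not_setMN [Finite S] {A : Set S} (hA : MulClosed A)
    (h : ¬ SetMN A) : ∃ z ∈ A, Recurrent z := by
  obtain ⟨z, hz, B, hne, hB, hle⟩ := exists_sLive_of_not_setMN hA h
  exact ⟨z, hz, _, hne.image _, hB.jLive hle⟩

theorem NEdge.exists_recurrent [Finite S] {a b : S} (h : NEdge a b) :
    ∃ z, Recurrent z ∧ SLe z a ∧ SLe z b := by
  obtain ⟨z, -, B, hne, hB, hle⟩ :=
    exists_sLive_of_not_setMN (mulClosed_subsemigroup _) h.2
  refine ⟨z, ⟨_, hne.image _, hB.jLive hle⟩, hB.sLe_left_of_closure_pair hne, ?_⟩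
  rw [Set.pair_comm] at hB
  exact hB.sLe_left_of_closure_pair hne

theorem IsPN.not_setMNMod_of_recurrent [Finite S] (hPN : IsPN S) {z : S} (hz : Recurrent z)
    {A I : Set S} (hA : IsIdealIn Set.univ A) (hI : IsIdealIn Set.univ I) (hzA : z ∈ A)
    (hzI : z ∉ I) : ¬ SetMNMod I A := by
  obtain ⟨a, b, B, hab, hB, ha, hb⟩ := hz.exists_sLive
  obtain ⟨B', hne, hB'⟩ := hPN.exists_sLive_closure hB hab
  have hsub : ∀ g ∈ Subsemigroup.closure ({a, b} : Set S), g ∈ A := fun g hg =>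
    hA.mem_of_sLe (sLe_of_mem_closure_pair ha hb hg) hzA
  have hB'' : SLive A z B' := by
    intro c d hcd
    obtain ⟨h1, h2, h3, h4, h5, w, hw, hw'⟩ := hB' c d hcd
    exact ⟨h1, h2, h3, hsub c h4, hsub d h5, w, fun e he => hsub e (hw e he), hw'⟩
  exact hB''.not_setMNMod hne fun c hc h => hzI (hI.mem_of_sLe h hc)

theorem Recurrent.exists_sLe_mul {z s : S} (hz : Recurrent z) (hs : SLe z s) :
    ∃ q, SLe q z ∧ SLe z (s * q) := by
  obtain ⟨B, ⟨⟨a, b⟩, hab⟩, hB⟩ := hz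
  obtain ⟨-, ha, hb, w, hw⟩ := hB a b hab
  have h1 := (hB _ _ hw).2.1.1
  obtain ⟨p, q, hs⟩ := hs
  obtain ⟨g, h, hg⟩ := ha.2
  obtain ⟨c, hc⟩ := exists_coe_of_jLe (u := q * h * w * b) ((JLe.mul_left _ _).trans hb.2)
  refine ⟨c, ?_, ?_⟩
  · rw [SLe, hc]; exact (JLe.mul_left _ _).trans hb.2
  · rw [SLe, WithOne.coe_mul, hc]
    refine h1.trans ⟨g * p, 1, ?_⟩
    rw [← hg, ← hs]; simp only [mul_assoc, mul_one]

section PrincipalSeries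

variable (ps : PrincipalSeries S)

theorem PrincipalSeries.isIdealIn {i : ℕ} (h1 : 1 ≤ i) (h2 : i ≤ ps.m + 1) :
    IsIdealIn Set.univ (ps.C i) := by
  rcases h2.eq_or_lt with rfl | h
  · rw [ps.last]
    exact ⟨Set.empty_subset _, fun a ha => absurd ha id⟩
  · exact ps.ideal i h1 (Nat.lt_succ_iff.1 h)

theorem PrincipalSeries.subset_of_le {i j : ℕ} (h1 : 1 ≤ i) (hij : i ≤ j) (h2 : j ≤ ps.m + 1) :
    ps.C j ⊆ ps.C i := by
  induction j, hij using Nat.le_induction with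
  | base => exact subset_rfl
  | succ j hj ih => exact (ps.ssub j (by omega) (by omega)).subset.trans (ih (by omega))

theorem PrincipalSeries.exists_mem_diff {k : ℕ} (hkm : k ≤ ps.m + 1) {a : S}
    (ha : a ∈ ps.C k) : ∃ i, k ≤ i ∧ i ≤ ps.m ∧ a ∈ ps.C i \ ps.C (i + 1) := by
  by_contra! hcon
  have : ∀ j, k ≤ j → j ≤ ps.m + 1 → a ∈ ps.C j := by
    intro j hj
    induction j, hj using Nat.le_induction with
    | base => exact fun _ => ha
    | succ j hj ih =>
      intro hjm
      by_contra h
      exact hcon j hj (by omega) ⟨ih (by omega), h⟩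
  have h := this (ps.m + 1) hkm le_rfl
  rw [ps.last] at h
  exact h

theorem PrincipalSeries.sLe_of_mem_diff {i : ℕ} (h1 : 1 ≤ i) (h2 : i ≤ ps.m) {a b : S}
    (ha : a ∈ ps.C i \ ps.C (i + 1)) (hb : b ∈ ps.C i \ ps.C (i + 1)) : SLe b a := by
  have hI := ps.isIdealIn (i := i) h1 (by omega)
  have hI' := ps.isIdealIn (i := i + 1) (by omega) (by omega)
  have hD : IsIdealIn Set.univ (ps.C (i + 1) ∪ {s | SLe s a}) := by
    refine ⟨Set.subset_univ _, ?_⟩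
    rintro s (hs | hs) t -
    · exact ⟨Or.inl (hI'.2 s hs t trivial).1, Or.inl (hI'.2 s hs t trivial).2⟩
    · exact ⟨Or.inr ((SLe.mul_left _ _).trans hs), Or.inr ((SLe.mul_right _ _).trans hs)⟩
  rcases ps.maximal i h1 h2 _ hD Set.subset_union_left
    (Set.union_subset (ps.ssub i h1 h2).subset fun s hs => hI.mem_of_sLe hs ha.1) with h | h
  · exact absurd (h ▸ Or.inr (SLe.refl a)) ha.2
  · have hb' : b ∈ ps.C (i + 1) ∪ {s | SLe s a} := h ▸ hb.1
    exact hb'.resolve_left hb.2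

theorem PrincipalSeries.subset_fsetQ {z a : S} (hz : Recurrent z) (hza : SLe z a) {i j : ℕ}
    (hi : 1 ≤ i) (him : i ≤ ps.m) (hj : 1 ≤ j) (hjm : j ≤ ps.m)
    (ha : a ∈ ps.C i \ ps.C (i + 1)) (hzj : z ∈ ps.C j \ ps.C (j + 1)) (hij : j ≠ i) :
    ps.C i \ ps.C (i + 1) ⊆ FsetQ ps j := by
  intro s hs
  have hzs : SLe z s := hza.trans (ps.sLe_of_mem_diff hi him hs ha)
  have hzi : z ∈ ps.C i := (ps.isIdealIn hi (by omega)).mem_of_sLe hza ha.1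
  have hlt : i < j := by
    by_contra h
    exact hzj.2 (ps.subset_of_le (by omega) (by omega) (by omega) hzi)
  refine ⟨fun h => hs.2 (ps.subset_of_le (by omega) hlt (by omega) h), ?_⟩
  obtain ⟨q, hqz, hzq⟩ := hz.exists_sLe_mul hzs
  exact ⟨q, (ps.isIdealIn hj (by omega)).mem_of_sLe hqz hzj.1, Or.inl fun h =>
    hzj.2 ((ps.isIdealIn (by omega) (by omega)).mem_of_sLe hzq h)⟩

theorem IsIdealIn.mulClosed {I : Set S} (hI : IsIdealIn Set.univ I) : MulClosed I :=
  fun a _ b hb => (hI.2 b hb a trivial).1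

theorem IsPN.mem_kset_iff [Finite S] (hPN : IsPN S) (a : S) :
    a ∈ Kset ps ↔ ∀ z, Recurrent z → ¬ SLe z a := by
  constructor
  · rintro ⟨i, hi, him, ⟨hroot, hF⟩, ha⟩ z hz hza
    have below : ∀ {z b j}, Recurrent z → b ∈ ps.C i \ ps.C (i + 1) → SLe z b → 1 ≤ j →
        j ≤ ps.m → z ∈ ps.C j \ ps.C (j + 1) → j ≠ i → False := by
      intro z b j hz hb hzb hj hjm hzj hij
      exact hPN.not_setMNMod_of_recurrent hz (ps.isIdealIn hj (by omega))
        (ps.isIdealIn (by omega) (by omega)) hzj.1 hzj.2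
        (hF j hj hjm (ps.subset_fsetQ hz hzb hi him hj hjm hb hzj hij))
    obtain ⟨j, hj, hjm, hzj⟩ := ps.exists_mem_diff (k := 1) (by omega) (a := z)
      (by rw [ps.first]; trivial)
    rcases ne_or_eq j i with hij | rfl
    · exact below hz ha hza hj hjm hzj hij
    · refine hroot ⟨hPN.not_setMNMod_of_recurrent hz (ps.isIdealIn hj (by omega))
        (ps.isIdealIn (by omega) (by omega)) hzj.1 hzj.2, fun c hc d hd hcd => ?_⟩
      obtain ⟨z', hz', hzc, hzd⟩ := hcd.exists_recurrent
      obtain ⟨k, _, hkm, hzk⟩ := ps.exists_mem_diff (k := j + 1) (by omega)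
        ((ps.isIdealIn (by omega) (by omega)).mem_of_sLe hzd hd)
      exact below hz' hc hzc (by omega) hkm hzk (by omega)
  · intro h
    obtain ⟨i, hi, him, ha⟩ := ps.exists_mem_diff (k := 1) (by omega) (a := a)
      (by rw [ps.first]; trivial)
    have hideal : ∀ j, 1 ≤ j → j ≤ ps.m → IsIdealIn (ps.C j) (ps.C (j + 1)) := fun j hj hjm =>
      ⟨(ps.ssub j hj hjm).subset, fun b hb t _ =>
        (ps.isIdealIn (by omega) (by omega)).2 b hb t trivial⟩
    refine ⟨i, hi, him, ⟨fun hroot => ?_, fun j hj hjm hsub => ?_⟩, ha⟩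
    · obtain ⟨z, hz, hz', hrec⟩ := exists_recurrent_of_not_setMNMod
        (ps.isIdealIn hi (by omega)).mulClosed (hideal i hi him) hroot.1
      exact h z hrec (ps.sLe_of_mem_diff hi him ha ⟨hz, hz'⟩)
    · by_contra hn
      obtain ⟨z, hz, hz', hrec⟩ := exists_recurrent_of_not_setMNMod
        (ps.isIdealIn hj (by omega)).mulClosed (hideal j hj hjm) hn
      obtain ⟨-, c, hc, hac⟩ := hsub ha
      have hCj := (ps.isIdealIn hj (by omega)).2 c hc a trivial
      rcases hac with hac | hac
      · exact h z hrec ((ps.sLe_of_mem_diff hj hjm ⟨hCj.1, hac⟩ ⟨hz, hz'⟩).trans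
          (SLe.mul_right _ _))
      · exact h z hrec ((ps.sLe_of_mem_diff hj hjm ⟨hCj.2, hac⟩ ⟨hz, hz'⟩).trans
          (SLe.mul_left _ _))

end PrincipalSeries

end Semigroup

/-- Let `S` be a pseudo-nilpotent finite semigroup with a principal series.  The
union `K` of all isolated subsets `S_i \ S_{i+1}` is the largest Mal'cev nilpotent
ideal of `S`, and it equals the set of isolated vertices of `N_S`. -/
theorem stmt13 {S : Type*} [Semigroup S] [Finite S] [Nonempty S]
    (hPN : IsPN S) (ps : PrincipalSeries S) :
    IsIdealIn Set.univ (Kset ps) ∧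
    SetMN (Kset ps) ∧
    (∀ I : Set S, IsIdealIn Set.univ I → SetMN I → I ⊆ Kset ps) ∧
    Kset ps = {a : S | ∀ b : S, ¬ NEdge a b} := by
  have hK := hPN.mem_kset_iff ps
  have hideal : IsIdealIn Set.univ (Kset ps) := by
    refine ⟨Set.subset_univ _, fun a ha t _ => ⟨?_, ?_⟩⟩
    · exact (hK _).2 fun z hz h => (hK a).1 ha z hz (h.trans (SLe.mul_left _ _))
    · exact (hK _).2 fun z hz h => (hK a).1 ha z hz (h.trans (SLe.mul_right _ _))
  refine ⟨hideal, ?_, fun I hI hMN a ha => (hK a).2 fun z hz hza => ?_, ?_⟩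
  · by_contra hn
    obtain ⟨z, hz, hrec⟩ := exists_recurrent_of_not_setMN hideal.mulClosed hn
    exact (hK z).1 hz z hrec (SLe.refl z)
  · exact hPN.not_setMNMod_of_recurrent hz hI ⟨Set.empty_subset _, fun a ha => absurd ha id⟩
      (hI.mem_of_sLe hza ha) (Set.notMem_empty z) (hMN.setMNMod ∅)
  · ext a
    refine (hK a).trans ⟨fun h b hab => ?_, fun h z hz hza => ?_⟩
    · obtain ⟨z, hz, hza, -⟩ := hab.exists_recurrent
      exact h z hz hza
    · obtain ⟨b, hb⟩ := hPN.exists_nEdge hz hza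
      exact h b hb
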